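/- Let A be a commutative Noetherian ring and M a nonzero finitely generated A-module with Ass(M) = {p_1, …, p_n}, the p_i pairwise distinct, and assume p_i + p_j = A for all i ≠ j. Let 0 = G_0 ⊆ G_1 ⊆ ⋯ ⊆ G_n = M be a coprimary filtration of M with respect to the enumeration p_1, …, p_n, so that Ass(G_i/G_{i-1}) = {p_i} for each i. Then for every i ∈ {0, 1, …, n}, G_i = ⋂_{j > i} ker(M → M_{p_j}), where for i = n the empty intersection is M. -/

import Mathlib

/-- A coprimary filtration of `M` with respect to the enumeration `p 0, …, p (n-1)` of its
associated primes: a chain `0 = G 0 ⊆ G 1 ⊆ ⋯ ⊆ G n = M` with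
`Ass(G (i+1) / G i) = {p i}` for each `i`. -/
def IsCoprimaryFiltration {A : Type*} [CommRing A] {M : Type*} [AddCommGroup M] [Module A M]
    {n : ℕ} (p : Fin n → Ideal A) (G : Fin (n + 1) → Submodule A M) : Prop :=
  G 0 = ⊥ ∧ G (Fin.last n) = ⊤ ∧ Monotone G ∧
  ∀ i : Fin n,
    associatedPrimes A
      (↥(G i.succ) ⧸ Submodule.comap (G i.succ).subtype (G i.castSucc)) = {p i}

section CoprimaryQuotient

variable {A : Type*} [CommRing A] [IsNoetherianRing A] {M : Type*} [AddCommGroup M] [Module A M]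

lemma eq_zero_of_smul_eq_zero_of_associatedPrimes_eq_singleton {p : Ideal A}
    (hp : associatedPrimes A M = {p}) {s : A} (hs : s ∉ p) {x : M} (hx : s • x = 0) : x = 0 := by
  by_contra hne
  have hmem : s ∈ ⋃ q ∈ associatedPrimes A M, (q : Set A) := by
    rw [biUnion_associatedPrimes_eq_zero_divisors]
    exact ⟨x, hne, hx⟩
  simp only [hp, Set.mem_singleton_iff, Set.iUnion_iUnion_eq_left] at hmem
  exact hs hmem

lemma exists_pow_mem_annihilator_of_associatedPrimes_eq_singleton [Module.Finite A M]
    {p : Ideal A} (hp : associatedPrimes A M = {p}) {a : A} (ha : a ∈ p) :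
    ∃ k : ℕ, a ^ k ∈ Module.annihilator A M := by
  change a ∈ (Module.annihilator A M).radical
  rw [← Ideal.sInf_minimalPrimes, Submodule.mem_sInf]
  intro q hq
  have hqp : q ∈ associatedPrimes A M :=
    Module.associatedPrimes.minimalPrimes_annihilator_subset_associatedPrimes A M hq
  rw [hp, Set.mem_singleton_iff] at hqp
  exact hqp ▸ ha

variable {N L : Submodule A M} {p : Ideal A}

lemma mem_of_smul_mem_of_associatedPrimes_quotient_eq_singleton
    (hp : associatedPrimes A (N ⧸ L.comap N.subtype) = {p}) {s : A} (hs : s ∉ p) {x : M}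
    (hxN : x ∈ N) (hx : s • x ∈ L) : x ∈ L := by
  have hzero : (L.comap N.subtype).mkQ ⟨x, hxN⟩ = 0 := by
    refine eq_zero_of_smul_eq_zero_of_associatedPrimes_eq_singleton hp hs ?_
    rw [← map_smul, Submodule.mkQ_apply, Submodule.Quotient.mk_eq_zero]
    exact hx
  rwa [Submodule.mkQ_apply, Submodule.Quotient.mk_eq_zero] at hzero

lemma exists_pow_smul_mem_of_associatedPrimes_quotient_eq_singleton [Module.Finite A M]
    (hp : associatedPrimes A (N ⧸ L.comap N.subtype) = {p}) {a : A} (ha : a ∈ p) {x : M}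
    (hxN : x ∈ N) : ∃ k : ℕ, a ^ k • x ∈ L := by
  obtain ⟨k, hk⟩ := exists_pow_mem_annihilator_of_associatedPrimes_eq_singleton hp ha
  refine ⟨k, ?_⟩
  have hzero := Module.mem_annihilator.mp hk ((L.comap N.subtype).mkQ ⟨x, hxN⟩)
  rw [← map_smul, Submodule.mkQ_apply, Submodule.Quotient.mk_eq_zero] at hzero
  exact hzero

end CoprimaryQuotient

/-- Let `A` be a commutative Noetherian ring and `M` a nonzero finitely
generated `A`-module with `Ass(M) = {p 0, …, p (n-1)}`, the `p i` pairwise distinct and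
pairwise comaximal.  If `0 = G₀ ⊆ ⋯ ⊆ Gₙ = M` is a coprimary filtration of `M` with
respect to the enumeration `p`, then `Gᵢ = ⋂_{j ≥ i} ker (M → M_{p j})` for every `i`
(for `i = n` the empty intersection is `M`). -/
theorem coprimary_filtration_eq_iInf_ker
    {A : Type*} [CommRing A] [IsNoetherianRing A]
    {M : Type*} [AddCommGroup M] [Module A M] [Module.Finite A M] [Nontrivial M]
    {n : ℕ} (p : Fin n → Ideal A) (hprime : ∀ i, (p i).IsPrime)
    (hinj : Function.Injective p)
    (hAss : associatedPrimes A M = Set.range p)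
    (horder : ∀ a b, p a < p b → b < a)
    (hcomax : ∀ i j, i ≠ j → p i ⊔ p j = ⊤)
    (G : Fin (n + 1) → Submodule A M) (hG : IsCoprimaryFiltration p G) :
    ∀ i : Fin (n + 1),
      G i = ⨅ (j : Fin n) (_ : (i : ℕ) ≤ (j : ℕ)),
        LinearMap.ker (LocalizedModule.mkLinearMap
          (@Ideal.primeCompl A _ (p j) (hprime j)) M) := by
  obtain ⟨hbot, htop, -, hquot⟩ := hG
  intro i
  ext m
  simp only [Submodule.mem_iInf, LocalizedModule.mem_ker_mkLinearMap_iff]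
  constructor
  · intro hm j hij
    induction i using Fin.induction generalizing m with
    | zero =>
      rw [hbot, Submodule.mem_bot] at hm
      exact ⟨1, (@Ideal.primeCompl A _ (p j) (hprime j)).one_mem, by simp [hm]⟩
    | succ k ih =>
      have hkj : (k : ℕ) < j := by simpa [Nat.succ_le_iff] using hij
      obtain ⟨a, hak, haj⟩ : ∃ a ∈ p k, a ∉ p j := by
        refine SetLike.not_le_iff_exists.mp fun hle => (hprime j).ne_top ?_
        rw [← hcomax k j (by rintro rfl; exact lt_irrefl _ hkj), sup_eq_right.mpr hle]
      obtain ⟨e, he⟩ :=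
        exists_pow_smul_mem_of_associatedPrimes_quotient_eq_singleton (hquot k) hak hm
      obtain ⟨s, hs, hsm⟩ := ih _ he (by simpa using hkj.le)
      refine ⟨s * a ^ e, ?_, by rw [mul_smul, hsm]⟩
      exact mul_mem hs (pow_mem (S := @Ideal.primeCompl A _ (p j) (hprime j)) haj e)
  · intro hm
    induction i using Fin.reverseInduction with
    | last => simp [htop]
    | cast k ih =>
      obtain ⟨s, hs, hsm⟩ := hm k (by simp)
      refine mem_of_smul_mem_of_associatedPrimes_quotient_eq_singleton (hquot k) hs
        (ih fun j hj => hm j ?_) (by simp [hsm])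
      simp only [Fin.val_succ, Fin.val_castSucc] at hj ⊢
      omega
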